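/- arXiv:2401.08024 — 3 statements merged into one kernel-verified Lean document; each statement's English description precedes it below -/
import Mathlib

section
/- Pointwise convergence of AdaBB: the sequence {x^k} generated by the general AdaBB iteration converges to a minimizer of f, and for every k ≥ 1, min_{1≤i≤k} ‖∇f(x^i)‖² ≤ L·Υ_1/(c·k), where c = min{α_0, 1/(√2·L)}. -/
open scoped RealInnerProductSpace
open Finset Filter

noncomputable section

/-- The general AdaBB iteration (Algorithm 2 of the paper) for a convex differentiable
function `f : ℝⁿ → ℝ` that attains its minimum.  `f'` is the gradient of `f`,
`x` the iterates, `α` the stepsizes, `θ` the stepsize ratios and `lam` the short BB stepsizes. -/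
structure AdaBB (n : ℕ) where
  f : EuclideanSpace ℝ (Fin n) → ℝ
  f' : EuclideanSpace ℝ (Fin n) → EuclideanSpace ℝ (Fin n)
  x : ℕ → EuclideanSpace ℝ (Fin n)
  α : ℕ → ℝ
  θ : ℕ → ℝ
  lam : ℕ → ℝ
  hconv : ConvexOn ℝ Set.univ f
  hgrad : ∀ y, HasGradientAt f (f' y) y
  hmin : ∃ z, ∀ y, f z ≤ f y
  hα0 : 0 < α 0
  hθ0 : 0 ≤ θ 0
  hx1 : x 1 = x 0 - α 0 • f' (x 0)
  hne : ∀ k, f' (x (k + 1)) ≠ f' (x k)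
  hlam : ∀ k, lam (k + 1) =
    ⟪f' (x (k + 1)) - f' (x k), x (k + 1) - x k⟫ / ‖f' (x (k + 1)) - f' (x k)‖ ^ 2
  hlampos : ∀ k, 0 < lam (k + 1)
  hcase1 : ∀ k, α k ≤ lam (k + 1) →
    α (k + 1) = Real.sqrt (1 + θ k) * α k ∧ θ (k + 1) = α (k + 1) / α k
  hcase2 : ∀ k, α k / 2 < lam (k + 1) → lam (k + 1) < α k →
    (α (k + 1) = min (Real.sqrt (lam (k + 1) / (2 * (α k - lam (k + 1)))))
        (Real.sqrt ((1 + θ k) * lam (k + 1) / (2 * lam (k + 1) - α k))) * α k ∨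
      α (k + 1) = lam (k + 1)) ∧
    θ (k + 1) = 2 * α (k + 1) / α k - α (k + 1) / lam (k + 1)
  hcase3 : ∀ k, lam (k + 1) ≤ α k / 2 →
    (α (k + 1) = Real.sqrt (α k / (2 * (α k - lam (k + 1)))) * lam (k + 1) ∨
      α (k + 1) = lam (k + 1) / Real.sqrt 2) ∧
    θ (k + 1) = α (k + 1) / α k
  hstep : ∀ k, x (k + 2) = x (k + 1) - α (k + 1) • f' (x (k + 1))

namespace AdaBB

variable {n : ℕ}

/-- `M_k` (for `k ≥ 1`). -/
def M (S : AdaBB n) (k : ℕ) : ℝ :=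
  if S.α (k - 1) ≤ S.lam k then 0
  else if S.α (k - 1) / 2 < S.lam k then
    S.α k ^ 2 / (S.lam k * S.α (k - 1)) - S.α k ^ 2 / S.α (k - 1) ^ 2
  else S.α k ^ 2 / S.lam k ^ 2 - S.α k ^ 2 / (S.α (k - 1) * S.lam k)

/-- `P_k` for `k ≥ 1`. -/
def Paux (S : AdaBB n) (k : ℕ) : ℝ :=
  if S.α (k - 1) ≤ S.lam k then S.α k ^ 2 / S.α (k - 1)
  else if S.α (k - 1) / 2 < S.lam k then
    2 * S.α k ^ 2 / S.α (k - 1) - S.α k ^ 2 / S.lam k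
  else S.α k ^ 2 / S.α (k - 1)

/-- `P_k`, with the convention `P_0 = P_1 - α_0`. -/
def P (S : AdaBB n) (k : ℕ) : ℝ :=
  if k = 0 then S.Paux 1 - S.α 0 else S.Paux k

/-- `w_k = α_k + P_k - P_{k+1}`. -/
def w (S : AdaBB n) (k : ℕ) : ℝ := S.α k + S.P k - S.P (k + 1)

/-- The Lyapunov function `Υ_k` (for `k ≥ 1`), relative to a minimizer `xs` of `f`. -/
def Upsilon (S : AdaBB n) (xs : EuclideanSpace ℝ (Fin n)) (k : ℕ) : ℝ :=
  ‖S.x k - xs‖ ^ 2 + 2 * S.M k * ‖S.x k - S.x (k - 1)‖ ^ 2 +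
    (2 * S.α (k - 1) + 2 * S.P (k - 1)) * (S.f (S.x (k - 1)) - S.f xs)

end AdaBB

end
namespace AdaBB

variable {n : ℕ}

/-- First-order convexity inequality. -/
theorem first_order (S : AdaBB n) (x y : EuclideanSpace ℝ (Fin n)) :
    S.f x + ⟪S.f' x, y - x⟫ ≤ S.f y := by
  have hlin : HasDerivAt (fun t : ℝ => x + t • (y - x)) (y - x) 0 := by
    simpa using ((hasDerivAt_id (0 : ℝ)).smul_const (y - x)).const_add x
  have hF : HasFDerivAt S.f (InnerProductSpace.toDual ℝ _ (S.f' x)) (x + (0 : ℝ) • (y - x)) := by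
    simpa using (S.hgrad x).hasFDerivAt
  have hd : HasDerivAt (fun t : ℝ => S.f (x + t • (y - x))) ⟪S.f' x, y - x⟫ 0 := by
    have h := hF.comp_hasDerivAt (0 : ℝ) hlin
    rw [InnerProductSpace.toDual_apply_apply] at h
    exact h
  have hc : ConvexOn ℝ Set.univ (fun t : ℝ => S.f (x + t • (y - x))) := by
    refine ⟨convex_univ, fun s _ t _ a b ha hb hab => ?_⟩
    have h := S.hconv.2 (Set.mem_univ (x + s • (y - x))) (Set.mem_univ (x + t • (y - x))) ha hb hab
    have e : x + (a • s + b • t) • (y - x) = a • (x + s • (y - x)) + b • (x + t • (y - x)) := by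
      have : b = 1 - a := by linarith
      subst this
      simp only [smul_eq_mul]
      module
    simp only [e]
    exact h
  have h := hc.le_slope_of_hasDerivAt (Set.mem_univ 0) (Set.mem_univ 1) one_pos hd
  simp [slope_def_field] at h
  linarith

/-- Real-number facts about one update of the step size. -/
theorem step_facts (S : AdaBB n) (k : ℕ) (ha : 0 < S.α k) (hθ : 0 ≤ S.θ k) :
    0 < S.α (k + 1) ∧ 0 ≤ S.θ (k + 1) ∧ 0 ≤ S.M (k + 1) ∧ S.M (k + 1) ≤ 1 / 2 ∧
    S.P (k + 1) = S.θ (k + 1) * S.α (k + 1) ∧ S.P (k + 1) ≤ (1 + S.θ k) * S.α k ∧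
    (∀ L : ℝ, 0 < L → 1 / L ≤ S.lam (k + 1) →
      min (S.α k) (1 / (Real.sqrt 2 * L)) ≤ S.α (k + 1)) := by
  have hl := S.hlampos k
  have h1 := S.hcase1 k
  have h2 := S.hcase2 k
  have h3 := S.hcase3 k
  have hs2 : 0 < Real.sqrt 2 := by positivity
  have hs2' : 1 ≤ Real.sqrt 2 := by
    rw [Real.one_le_sqrt]; norm_num
  have hs2q : Real.sqrt 2 ^ 2 = 2 := Real.sq_sqrt (by norm_num)
  have hP : S.P (k + 1) = S.Paux (k + 1) := by simp [P]
  rw [hP]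
  unfold M Paux
  simp only [Nat.add_sub_cancel]
  generalize S.α (k + 1) = b at *
  generalize S.θ (k + 1) = θ' at *
  generalize S.lam (k + 1) = l at *
  generalize S.α k = a at *
  generalize S.θ k = θ at *
  have hLL : ∀ L : ℝ, 0 < L → 1 / L ≤ l → 1 / (Real.sqrt 2 * L) ≤ l / Real.sqrt 2 := by
    intro L hL h
    have : 1 / (Real.sqrt 2 * L) = (1 / L) / Real.sqrt 2 := by field_simp
    rw [this]
    gcongr
  have hl2 : l / Real.sqrt 2 ≤ l := div_le_self hl.le hs2'
  by_cases c1 : a ≤ l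
  · obtain ⟨hb, ht⟩ := h1 c1
    have hsq : 1 ≤ Real.sqrt (1 + θ) := by
      rw [Real.one_le_sqrt]; linarith
    have hb0 : 0 < b := by rw [hb]; positivity
    have hb2 : b ^ 2 = (1 + θ) * a ^ 2 := by
      rw [hb, mul_pow, Real.sq_sqrt (by linarith)]
    simp only [if_pos c1]
    refine ⟨hb0, by rw [ht]; positivity, le_rfl, by norm_num, by rw [ht]; ring, ?_, ?_⟩
    · rw [hb2]; apply le_of_eq; field_simp
    · intro L _ _
      refine (min_le_left _ _).trans ?_
      rw [hb]; nlinarith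
  · have c1' : l < a := not_le.mp c1
    simp only [if_neg c1]
    by_cases c2 : a / 2 < l
    · obtain ⟨hb, ht⟩ := h2 c2 c1'
      simp only [if_pos c2]
      have hal : 0 < a - l := by linarith
      have hla : 0 < 2 * l - a := by linarith
      have key : 0 < b ∧ b ^ 2 * (a - l) ≤ 1 / 2 * (l * a ^ 2) ∧
          b ^ 2 * (2 * l - a) ≤ (1 + θ) * a * (a * l) ∧ l / Real.sqrt 2 ≤ b := by
        rcases hb with hb | hb
        · set u := l / (2 * (a - l)) with hu
          set v := (1 + θ) * l / (2 * l - a) with hv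
          have hu0 : 0 < u := by positivity
          have hv0 : 0 < v := by positivity
          have hm0 : 0 < min (Real.sqrt u) (Real.sqrt v) := by
            apply lt_min <;> positivity
          have hmu : min (Real.sqrt u) (Real.sqrt v) ^ 2 ≤ u := by
            calc _ ≤ Real.sqrt u ^ 2 := by gcongr; exact min_le_left _ _
              _ = u := Real.sq_sqrt hu0.le
          have hmv : min (Real.sqrt u) (Real.sqrt v) ^ 2 ≤ v := by
            calc _ ≤ Real.sqrt v ^ 2 := by gcongr; exact min_le_right _ _
              _ = v := Real.sq_sqrt hv0.le
          have hu1 : 1 / 2 ≤ u := by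
            rw [hu, div_le_div_iff₀ (by norm_num) (by positivity)]; linarith
          have hv1 : 1 / 2 ≤ v := by
            rw [hv, div_le_div_iff₀ (by norm_num) (by positivity)]; nlinarith
          have hml : 1 / Real.sqrt 2 ≤ min (Real.sqrt u) (Real.sqrt v) := by
            have e : 1 / Real.sqrt 2 = Real.sqrt (1 / 2) := by simp
            rw [e]
            exact le_min (Real.sqrt_le_sqrt hu1) (Real.sqrt_le_sqrt hv1)
          have hue : u * (a - l) = l / 2 := by rw [hu]; field_simp
          have hve : v * (2 * l - a) = (1 + θ) * l := by
            rw [hv]; exact div_mul_cancel₀ _ hla.ne'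
          refine ⟨by rw [hb]; positivity, ?_, ?_, ?_⟩
          · rw [hb, mul_pow]
            calc _ ≤ u * a ^ 2 * (a - l) := by gcongr
              _ = (u * (a - l)) * a ^ 2 := by ring
              _ ≤ _ := by rw [hue]; apply le_of_eq; ring
          · rw [hb, mul_pow]
            calc _ ≤ v * a ^ 2 * (2 * l - a) := by gcongr
              _ = (v * (2 * l - a)) * a ^ 2 := by ring
              _ ≤ _ := by rw [hve]; apply le_of_eq; ring
          · rw [hb]
            calc l / Real.sqrt 2 = 1 / Real.sqrt 2 * l := by ring
              _ ≤ _ := by gcongr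
        · rw [hb]
          refine ⟨hl, ?_, ?_, hl2⟩
          · nlinarith [mul_nonneg hl.le (sq_nonneg (a - 2 * l)), mul_pos hl (mul_pos ha ha)]
          · have e1 : l * (2 * l - a) ≤ a * a := by nlinarith
            have e2 : 0 ≤ θ * (a * a) := by positivity
            nlinarith [mul_le_mul_of_nonneg_left e1 hl.le, mul_nonneg hl.le e2]
      obtain ⟨hb0, hM, hPP, hlow⟩ := key
      have eM : b ^ 2 / (l * a) - b ^ 2 / a ^ 2 = b ^ 2 * (a - l) / (l * a ^ 2) := by
        field_simp
      have eP : 2 * b ^ 2 / a - b ^ 2 / l = b ^ 2 * (2 * l - a) / (a * l) := by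
        field_simp
      have eθ : 2 * b / a - b / l = b * (2 * l - a) / (a * l) := by
        field_simp
      rw [eM, ht, eP, eθ]
      refine ⟨hb0, by positivity, by positivity, ?_, by ring, ?_, ?_⟩
      · rw [div_le_iff₀ (by positivity)]; exact hM
      · rw [div_le_iff₀ (by positivity)]; exact hPP
      · intro L hL h
        exact (min_le_right _ _).trans ((hLL L hL h).trans hlow)
    · simp only [if_neg c2]
      have c2' : l ≤ a / 2 := not_lt.mp c2
      obtain ⟨hb, ht⟩ := h3 c2'
      have hal : 0 < a - l := by linarith
      have key : 0 < b ∧ b ^ 2 * (a - l) ≤ 1 / 2 * (a * l ^ 2) ∧ b ≤ l ∧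
          l / Real.sqrt 2 ≤ b := by
        rcases hb with hb | hb
        · set u := a / (2 * (a - l)) with hu
          have hu0 : 0 < u := by positivity
          have hu1 : 1 / 2 ≤ u := by
            rw [hu, div_le_div_iff₀ (by norm_num) (by positivity)]; linarith
          have hu2 : u ≤ 1 := by
            rw [hu, div_le_one (by positivity)]; linarith
          have hue : u * (a - l) = a / 2 := by rw [hu]; field_simp
          refine ⟨by rw [hb]; positivity, ?_, ?_, ?_⟩
          · rw [hb, mul_pow, Real.sq_sqrt hu0.le]
            have : u * l ^ 2 * (a - l) = (u * (a - l)) * l ^ 2 := by ring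
            rw [this, hue]; apply le_of_eq; ring
          · rw [hb]
            have : Real.sqrt u ≤ 1 := Real.sqrt_le_one.mpr hu2
            nlinarith
          · rw [hb]
            have e : 1 / Real.sqrt 2 = Real.sqrt (1 / 2) := by simp
            calc l / Real.sqrt 2 = 1 / Real.sqrt 2 * l := by ring
              _ ≤ _ := by rw [e]; gcongr
        · refine ⟨by rw [hb]; positivity, ?_, by rw [hb]; exact hl2, hb.ge⟩
          rw [hb, div_pow, hs2q]
          nlinarith [pow_pos hl 3]
      obtain ⟨hb0, hM, hbl, hlow⟩ := key
      have eM : b ^ 2 / l ^ 2 - b ^ 2 / (a * l) = b ^ 2 * (a - l) / (a * l ^ 2) := by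
        field_simp
      rw [eM, ht]
      refine ⟨hb0, by positivity, by positivity, ?_, by ring, ?_, ?_⟩
      · rw [div_le_iff₀ (by positivity)]; exact hM
      · rw [div_le_iff₀ (by positivity)]
        have : 0 ≤ θ * (a * a) := by positivity
        nlinarith
      · intro L hL h
        exact (min_le_right _ _).trans ((hLL L hL h).trans hlow)

theorem pos (S : AdaBB n) (k : ℕ) : 0 < S.α k ∧ 0 ≤ S.θ k := by
  induction k with
  | zero => exact ⟨S.hα0, S.hθ0⟩
  | succ k ih =>
    have h := S.step_facts k ih.1 ih.2
    exact ⟨h.1, h.2.1⟩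

theorem step (S : AdaBB n) (k : ℕ) : S.x (k + 1) = S.x k - S.α k • S.f' (S.x k) := by
  cases k with
  | zero => exact S.hx1
  | succ k => exact S.hstep k

/-- The key bound on the squared step. -/
theorem grad_bound (S : AdaBB n) (k : ℕ) :
    S.α (k + 1) ^ 2 * ‖S.f' (S.x (k + 1))‖ ^ 2 ≤
      S.P (k + 1) * (S.f (S.x k) - S.f (S.x (k + 1))) +
        S.M (k + 1) * ‖S.x (k + 1) - S.x k‖ ^ 2 := by
  have ha := (S.pos k).1
  have hb := (S.pos (k + 1)).1
  have hl := S.hlampos k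
  have hlam := S.hlam k
  have hy : 0 < ‖S.f' (S.x (k + 1)) - S.f' (S.x k)‖ ^ 2 := by
    have := norm_pos_iff.mpr (sub_ne_zero.mpr (S.hne k))
    positivity
  rw [eq_div_iff hy.ne'] at hlam
  have hd : S.x (k + 1) - S.x k = -(S.α k • S.f' (S.x k)) := by rw [S.step k]; abel
  have hd' : S.x k - S.x (k + 1) = S.α k • S.f' (S.x k) := by rw [S.step k]; abel
  have hconv := S.first_order (S.x (k + 1)) (S.x k)
  have hcs := real_inner_le_norm (S.f' (S.x (k + 1)) - S.f' (S.x k)) (S.x (k + 1) - S.x k)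
  rw [← hlam] at hcs
  rw [hd', inner_smul_right] at hconv
  have hD : S.α k * ⟪S.f' (S.x (k + 1)), S.f' (S.x k)⟫ ≤ S.f (S.x k) - S.f (S.x (k + 1)) := by
    linarith
  clear hconv
  have hY0 : 0 < ‖S.f' (S.x (k + 1)) - S.f' (S.x k)‖ :=
    norm_pos_iff.mpr (sub_ne_zero.mpr (S.hne k))
  have hP : S.P (k + 1) = S.Paux (k + 1) := by simp [P]
  rw [hP]
  rw [hd, norm_neg, norm_smul, Real.norm_eq_abs, abs_of_pos ha] at hcs ⊢
  rw [hd, inner_neg_right, inner_smul_right, inner_sub_left, real_inner_self_eq_norm_sq] at hlam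
  have hexp := norm_sub_sq_real (S.f' (S.x (k + 1))) (S.f' (S.x k))
  unfold M Paux
  simp only [Nat.add_sub_cancel]
  generalize S.α (k + 1) = b at *
  generalize S.lam (k + 1) = l at *
  generalize S.α k = a at *
  generalize S.f (S.x k) - S.f (S.x (k + 1)) = D at *
  generalize ⟪S.f' (S.x (k + 1)), S.f' (S.x k)⟫ = I at *
  generalize ‖S.f' (S.x (k + 1)) - S.f' (S.x k)‖ = Y at *
  generalize ‖S.f' (S.x (k + 1))‖ = G at *
  generalize ‖S.f' (S.x k)‖ = H at *
  have hG : a * G ^ 2 = a * I + (a - l) * Y ^ 2 := by linear_combination hlam - a * hexp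
  by_cases c1 : a ≤ l
  · simp only [if_pos c1]
    have h1 : a * G ^ 2 ≤ D := by nlinarith
    calc b ^ 2 * G ^ 2 = b ^ 2 / a * (a * G ^ 2) := by field_simp
      _ ≤ b ^ 2 / a * D := by gcongr
      _ = _ := by ring
  · have c1' : l < a := not_le.mp c1
    have hal : 0 < a - l := by linarith
    simp only [if_neg c1]
    by_cases c2 : a / 2 < l
    · simp only [if_pos c2]
      have hla : 0 < 2 * l - a := by linarith
      have h1 : a * l * G ^ 2 = (2 * l - a) * (a * I) + (a - l) * (a * H ^ 2) := by
        linear_combination l * hG + (a - l) * hlam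
      have h2 : a * l * G ^ 2 ≤ (2 * l - a) * D + (a - l) * (a * H ^ 2) := by
        rw [h1]; gcongr
      calc b ^ 2 * G ^ 2 = b ^ 2 / (a * l) * (a * l * G ^ 2) := by field_simp
        _ ≤ b ^ 2 / (a * l) * ((2 * l - a) * D + (a - l) * (a * H ^ 2)) := by gcongr
        _ = _ := by field_simp
    · simp only [if_neg c2]
      have h0 : l * Y ≤ a * H := by
        refine le_of_mul_le_mul_right ?_ hY0
        nlinarith
      have h1 : (l * Y) ^ 2 ≤ (a * H) ^ 2 := by gcongr
      have h2 : Y ^ 2 ≤ (a * H) ^ 2 / l ^ 2 := by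
        rw [le_div_iff₀ (by positivity)]; nlinarith
      have h3 : a * G ^ 2 ≤ D + (a - l) * ((a * H) ^ 2 / l ^ 2) := by
        rw [hG]; gcongr
      calc b ^ 2 * G ^ 2 = b ^ 2 / a * (a * G ^ 2) := by field_simp
        _ ≤ b ^ 2 / a * (D + (a - l) * ((a * H) ^ 2 / l ^ 2)) := by gcongr
        _ = _ := by field_simp

theorem M_nonneg (S : AdaBB n) (k : ℕ) : 0 ≤ S.M (k + 1) :=
  (S.step_facts k (S.pos k).1 (S.pos k).2).2.2.1

theorem M_le (S : AdaBB n) (k : ℕ) : S.M (k + 1) ≤ 1 / 2 :=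
  (S.step_facts k (S.pos k).1 (S.pos k).2).2.2.2.1

theorem P_eq (S : AdaBB n) (k : ℕ) : S.P (k + 1) = S.θ (k + 1) * S.α (k + 1) :=
  (S.step_facts k (S.pos k).1 (S.pos k).2).2.2.2.2.1

theorem P_nonneg (S : AdaBB n) (k : ℕ) : 0 ≤ S.P (k + 1) := by
  rw [P_eq]
  exact mul_nonneg (S.pos (k + 1)).2 (S.pos (k + 1)).1.le

/-- `w_k ≥ 0`. -/
theorem P_succ_le (S : AdaBB n) (k : ℕ) : S.P (k + 1) ≤ S.α k + S.P k := by
  cases k with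
  | zero => simp [P]
  | succ k =>
    have h := (S.step_facts (k + 1) (S.pos (k + 1)).1 (S.pos (k + 1)).2).2.2.2.2.2.1
    rw [P_eq S k]
    linarith

/-- One-step Lyapunov decrease. -/
theorem descent (S : AdaBB n) (z : EuclideanSpace ℝ (Fin n)) (hz : ∀ y, S.f z ≤ S.f y)
    (k : ℕ) (e : ℝ)
    (he : S.f (S.x (k + 1)) - S.f z + e ≤ ⟪S.f' (S.x (k + 1)), S.x (k + 1) - z⟫) :
    S.Upsilon z (k + 2) + 2 * S.α (k + 1) * e ≤ S.Upsilon z (k + 1) := by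
  have hg := S.grad_bound k
  have hM := S.M_le (k + 1)
  have hP := S.P_succ_le k
  have hb := (S.pos (k + 1)).1
  have hF := hz (S.x k)
  unfold Upsilon
  simp only [Nat.add_sub_cancel, show k + 2 - 1 = k + 1 from rfl]
  have e1 : S.x (k + 2) - z = (S.x (k + 1) - z) - S.α (k + 1) • S.f' (S.x (k + 1)) := by
    rw [S.hstep k]; abel
  have e2 : S.x (k + 2) - S.x (k + 1) = -(S.α (k + 1) • S.f' (S.x (k + 1))) := by
    rw [S.hstep k]; abel
  rw [e1, e2, norm_sub_sq_real, norm_neg, norm_smul, inner_smul_right, Real.norm_eq_abs,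
    abs_of_pos hb, real_inner_comm, mul_pow]
  have h1 := mul_le_mul_of_nonneg_left he hb.le
  have h2 : S.M (k + 2) * (S.α (k + 1) ^ 2 * ‖S.f' (S.x (k + 1))‖ ^ 2) ≤
      1 / 2 * (S.α (k + 1) ^ 2 * ‖S.f' (S.x (k + 1))‖ ^ 2) := by
    gcongr
  have h3 := mul_le_mul_of_nonneg_right hP (sub_nonneg.mpr hF)
  nlinarith

theorem Upsilon_antitone (S : AdaBB n) (z : EuclideanSpace ℝ (Fin n)) (hz : ∀ y, S.f z ≤ S.f y) :
    Antitone (fun k => S.Upsilon z (k + 1)) := by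
  refine antitone_nat_of_succ_le fun k => ?_
  have h := S.first_order (S.x (k + 1)) z
  have h' : ⟪S.f' (S.x (k + 1)), z - S.x (k + 1)⟫ = - ⟪S.f' (S.x (k + 1)), S.x (k + 1) - z⟫ := by
    rw [← inner_neg_right, neg_sub]
  have := S.descent z hz k 0 (by linarith)
  simpa using this

theorem norm_sq_le_Upsilon (S : AdaBB n) (z : EuclideanSpace ℝ (Fin n))
    (hz : ∀ y, S.f z ≤ S.f y) (k : ℕ) : ‖S.x (k + 1) - z‖ ^ 2 ≤ S.Upsilon z (k + 1) := by
  have h1 := mul_nonneg (S.M_nonneg k) (sq_nonneg ‖S.x (k + 1) - S.x k‖)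
  have h2 := mul_nonneg ((S.P_nonneg k).trans (S.P_succ_le k)) (sub_nonneg.mpr (hz (S.x k)))
  unfold Upsilon
  simp only [Nat.add_sub_cancel]
  linarith

/-- Opial-type argument. -/
theorem opial {E : Type*} [NormedAddCommGroup E] [InnerProductSpace ℝ E] [ProperSpace E]
    (x : ℕ → E) (Z : Set E) (q : ℕ → ℝ) (R : ℝ) (c : E) (hb : ∀ k, ‖x k - c‖ ≤ R)
    (hcl : ∀ z, ∀ φ : ℕ → ℕ, StrictMono φ → Tendsto (x ∘ φ) atTop (nhds z) → z ∈ Z)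
    (hlim : ∀ z ∈ Z, ∃ l, Tendsto (fun k => ‖x k - z‖ ^ 2 + q k) atTop (nhds l)) :
    ∃ z ∈ Z, Tendsto x atTop (nhds z) := by
  have hmem : ∀ k, x k ∈ Metric.closedBall c R := fun k => by
    simpa [dist_eq_norm] using hb k
  have hK : IsCompact (Metric.closedBall c R) := isCompact_closedBall c R
  obtain ⟨z, -, φ, hφ, hz⟩ := hK.tendsto_subseq hmem
  have hzZ := hcl z φ hφ hz
  refine ⟨z, hzZ, ?_⟩
  refine tendsto_of_subseq_tendsto fun ns hns => ?_
  obtain ⟨z', -, ψ, hψ, hz'⟩ := hK.tendsto_subseq (fun k => hmem (ns k))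
  have ht : Tendsto (fun k => ns (ψ k)) atTop atTop := hns.comp hψ.tendsto_atTop
  obtain ⟨χ, hχ, hχ'⟩ := strictMono_subseq_of_tendsto_atTop ht
  have hz'Z : z' ∈ Z := hcl z' _ hχ' (hz'.comp hχ.tendsto_atTop)
  obtain ⟨l, hl⟩ := hlim z hzZ
  obtain ⟨l', hl'⟩ := hlim z' hz'Z
  have hdiff := hl.sub hl'
  have e : ∀ k, (‖x k - z‖ ^ 2 + q k) - (‖x k - z'‖ ^ 2 + q k) =
      ‖x k - z‖ ^ 2 - ‖x k - z'‖ ^ 2 := fun k => by ring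
  simp only [e] at hdiff
  have hcont : Continuous (fun y : E => ‖y - z‖ ^ 2 - ‖y - z'‖ ^ 2) := by fun_prop
  have t1 := tendsto_nhds_unique (hdiff.comp hφ.tendsto_atTop) ((hcont.tendsto z).comp hz)
  have t2 := tendsto_nhds_unique (hdiff.comp ht) ((hcont.tendsto z').comp hz')
  have h : ‖z - z'‖ ^ 2 = 0 := by
    rw [t1] at t2
    simp only [sub_self, norm_zero, norm_sub_rev z' z] at t2
    nlinarith
  have hzz : z = z' := by
    have := pow_eq_zero_iff (two_ne_zero) |>.mp h
    exact sub_eq_zero.mp (norm_eq_zero.mp this)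
  subst hzz
  exact ⟨ψ, hz'⟩

theorem main (S : AdaBB n)
    (xs : EuclideanSpace ℝ (Fin n)) (hxs : ∀ y, S.f xs ≤ S.f y)
    (R : ℝ) (hR0 : 0 ≤ R)
    (hR2 : R ^ 2 = ‖S.x 0 - xs‖ ^ 2 + S.α 0 ^ 2 * (1 + 2 * S.M 1) * ‖S.f' (S.x 0)‖ ^ 2 +
      max (2 * S.P 1 - 2 * S.α 0) 0 * (S.f (S.x 0) - S.f xs))
    (L : ℝ) (hL : 0 < L)
    (hsmooth : ∀ x y : EuclideanSpace ℝ (Fin n), ‖x - xs‖ ≤ R → ‖y - xs‖ ≤ R →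
      (1 / (2 * L)) * ‖S.f' x - S.f' y‖ ^ 2 ≤ S.f x - S.f y - ⟪S.f' y, x - y⟫)
    (hcoco : ∀ x y : EuclideanSpace ℝ (Fin n), ‖x - xs‖ ≤ R → ‖y - xs‖ ≤ R →
      (1 / L) * ‖S.f' x - S.f' y‖ ^ 2 ≤ ⟪S.f' x - S.f' y, x - y⟫) :
    (∃ z, (∀ y, S.f z ≤ S.f y) ∧ Filter.Tendsto S.x Filter.atTop (nhds z)) ∧
    ∀ k : ℕ, ∀ hk : 1 ≤ k,
      (Finset.Icc 1 k).inf' (Finset.nonempty_Icc.mpr hk) (fun i => ‖S.f' (S.x i)‖ ^ 2) ≤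
        L * S.Upsilon xs 1 / (min (S.α 0) (1 / (Real.sqrt 2 * L)) * (k : ℝ)) := by
  have hF0 := sub_nonneg.mpr (hxs (S.x 0))
  have hM1 := S.M_nonneg 0
  rw [zero_add] at hM1
  have inner_flip : ∀ g u v : EuclideanSpace ℝ (Fin n), ⟪g, v - u⟫ = - ⟪g, u - v⟫ := by
    intro g u v
    rw [← inner_neg_right, neg_sub]
  -- gradient vanishes at the minimizer
  have hgxs : S.f' xs = 0 := by
    have h1 : IsLocalMin S.f xs := Filter.Eventually.of_forall hxs
    have h2 := h1.hasFDerivAt_eq_zero (S.hgrad xs).hasFDerivAt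
    simpa using h2
  -- the iterates stay in the ball
  have hU1 : S.Upsilon xs 1 ≤ R ^ 2 := by
    have hfo := S.first_order (S.x 0) xs
    rw [inner_flip _ (S.x 0) xs] at hfo
    have ha := S.hα0
    have hmax := mul_le_mul_of_nonneg_right (le_max_left (2 * S.P 1 - 2 * S.α 0) 0) hF0
    rw [hR2]
    unfold Upsilon
    simp only [Nat.sub_self]
    have hP0 : S.P 0 = S.P 1 - S.α 0 := by simp [P]
    have e1 : S.x 1 - xs = (S.x 0 - xs) - S.α 0 • S.f' (S.x 0) := by
      rw [S.hx1]; abel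
    have e2 : S.x 1 - S.x 0 = -(S.α 0 • S.f' (S.x 0)) := by
      rw [S.hx1]; abel
    rw [hP0, e1, e2, norm_sub_sq_real, norm_neg, norm_smul, inner_smul_right, Real.norm_eq_abs,
      abs_of_pos ha, real_inner_comm, mul_pow]
    nlinarith
  have hball : ∀ k, ‖S.x k - xs‖ ≤ R := by
    intro k
    refine abs_le_of_sq_le_sq' ?_ hR0 |>.2
    cases k with
    | zero =>
      rw [hR2]
      have h1 : 0 ≤ S.α 0 ^ 2 * (1 + 2 * S.M 1) * ‖S.f' (S.x 0)‖ ^ 2 := by positivity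
      have h2 := mul_nonneg (le_max_right (2 * S.P 1 - 2 * S.α 0) 0) hF0
      linarith
    | succ k =>
      exact (S.norm_sq_le_Upsilon xs hxs k).trans
        ((S.Upsilon_antitone xs hxs (Nat.zero_le k)).trans hU1)
  set c := min (S.α 0) (1 / (Real.sqrt 2 * L)) with hc
  have hc0 : 0 < c := lt_min S.hα0 (by positivity)
  have hαc : ∀ k, c ≤ S.α k := by
    intro k
    induction k with
    | zero => exact min_le_left _ _
    | succ k ih =>
      have h := (S.step_facts k (S.pos k).1 (S.pos k).2).2.2.2.2.2.2 L hL ?_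
      · exact (le_min ih (min_le_right _ _)).trans h
      · rw [S.hlam k, le_div_iff₀]
        · exact hcoco _ _ (hball _) (hball _)
        · have := norm_pos_iff.mpr (sub_ne_zero.mpr (S.hne k))
          positivity
  -- decrease
  have hdec : ∀ k, S.Upsilon xs (k + 2) + c / L * ‖S.f' (S.x (k + 1))‖ ^ 2 ≤
      S.Upsilon xs (k + 1) := by
    intro k
    have h := hsmooth xs (S.x (k + 1)) (by simpa using hR0) (hball _)
    rw [hgxs, zero_sub, norm_neg, inner_flip _ (S.x (k + 1)) xs] at h
    have h' := S.descent xs hxs k (1 / (2 * L) * ‖S.f' (S.x (k + 1))‖ ^ 2) (by linarith)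
    have e : 2 * S.α (k + 1) * (1 / (2 * L) * ‖S.f' (S.x (k + 1))‖ ^ 2) =
      S.α (k + 1) / L * ‖S.f' (S.x (k + 1))‖ ^ 2 := by field_simp
    rw [e] at h'
    have : c / L * ‖S.f' (S.x (k + 1))‖ ^ 2 ≤ S.α (k + 1) / L * ‖S.f' (S.x (k + 1))‖ ^ 2 := by
      gcongr
      exact hαc _
    linarith
  have hsum : ∀ k, ∑ i ∈ Finset.range k, c / L * ‖S.f' (S.x (i + 1))‖ ^ 2 +
      S.Upsilon xs (k + 1) ≤ S.Upsilon xs 1 := by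
    intro k
    induction k with
    | zero => simp
    | succ k ih =>
      rw [Finset.sum_range_succ]
      have := hdec k
      linarith
  have hUnn : ∀ k, 0 ≤ S.Upsilon xs (k + 1) := fun k =>
    (sq_nonneg _).trans (S.norm_sq_le_Upsilon xs hxs k)
  have hsum' : ∀ k, ∑ i ∈ Finset.range k, c / L * ‖S.f' (S.x (i + 1))‖ ^ 2 ≤ S.Upsilon xs 1 :=
    fun k => by linarith [hsum k, hUnn k]
  constructor
  · have hsummable : Summable (fun i => c / L * ‖S.f' (S.x (i + 1))‖ ^ 2) :=
      summable_of_sum_range_le (fun i => by positivity) hsum'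
    have ht := hsummable.tendsto_atTop_zero
    have ht2 : Tendsto (fun i => ‖S.f' (S.x (i + 1))‖) atTop (nhds 0) := by
      have h1 := (ht.const_mul (L / c)).sqrt
      have e : ∀ i, Real.sqrt (L / c * (c / L * ‖S.f' (S.x (i + 1))‖ ^ 2)) =
          ‖S.f' (S.x (i + 1))‖ := by
        intro i
        rw [← mul_assoc, div_mul_div_cancel₀ hc0.ne', div_self hL.ne', one_mul,
          Real.sqrt_sq (norm_nonneg _)]
      simpa only [e, mul_zero, Real.sqrt_zero] using h1
    have hval : Tendsto (fun i => S.f (S.x (i + 1))) atTop (nhds (S.f xs)) := by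
      have h1 : Tendsto (fun i => S.f xs + ‖S.f' (S.x (i + 1))‖ * R) atTop (nhds (S.f xs)) := by
        simpa using (ht2.mul_const R).const_add (S.f xs)
      refine tendsto_of_tendsto_of_tendsto_of_le_of_le tendsto_const_nhds h1
        (fun i => hxs _) (fun i => ?_)
      have h2 := S.first_order (S.x (i + 1)) xs
      rw [inner_flip _ (S.x (i + 1)) xs] at h2
      have h3 := real_inner_le_norm (S.f' (S.x (i + 1))) (S.x (i + 1) - xs)
      have h4 := mul_le_mul_of_nonneg_left (hball (i + 1)) (norm_nonneg (S.f' (S.x (i + 1))))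
      show S.f (S.x (i + 1)) ≤ _
      linarith
    have hcont : Continuous S.f :=
      continuous_iff_continuousAt.mpr fun y => (S.hgrad y).continuousAt
    obtain ⟨z, hz, hzt⟩ := opial (fun k => S.x (k + 1)) {z | ∀ y, S.f z ≤ S.f y}
      (fun k => 2 * S.M (k + 1) * ‖S.x (k + 1) - S.x k‖ ^ 2 +
        (2 * S.α k + 2 * S.P k) * (S.f (S.x k) - S.f xs)) R xs (fun k => hball _)
      (fun z φ hφ hz => by
        have h1 := (hcont.tendsto z).comp hz
        have h2 := hval.comp hφ.tendsto_atTop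
        have h3 : S.f z = S.f xs := tendsto_nhds_unique h1 h2
        intro y
        rw [h3]
        exact hxs y)
      (fun z hz => by
        have hfz : S.f z = S.f xs := le_antisymm (hz xs) (hxs z)
        have h1 := tendsto_atTop_ciInf (S.Upsilon_antitone z hz)
          ⟨0, by
            rintro _ ⟨k, rfl⟩
            exact (sq_nonneg _).trans (S.norm_sq_le_Upsilon z hz k)⟩
        refine ⟨_, h1.congr fun k => ?_⟩
        unfold Upsilon
        simp only [Nat.add_sub_cancel, hfz]
        ring)
    exact ⟨z, hz, (tendsto_add_atTop_iff_nat 1).mp hzt⟩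
  · intro k hk
    have hk0 : (0 : ℝ) < k := by exact_mod_cast hk
    rw [le_div_iff₀ (by positivity)]
    set m := (Finset.Icc 1 k).inf' (Finset.nonempty_Icc.mpr hk) (fun i => ‖S.f' (S.x i)‖ ^ 2)
      with hm
    have hle : ∀ i ∈ Finset.range k, c / L * m ≤ c / L * ‖S.f' (S.x (i + 1))‖ ^ 2 := by
      intro i hi
      have hi' := Finset.mem_range.mp hi
      have : m ≤ ‖S.f' (S.x (i + 1))‖ ^ 2 :=
        Finset.inf'_le (fun i => ‖S.f' (S.x i)‖ ^ 2) (Finset.mem_Icc.mpr ⟨by omega, by omega⟩)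
      gcongr
    have h1 := (Finset.sum_le_sum hle).trans (hsum' k)
    rw [Finset.sum_const, Finset.card_range, nsmul_eq_mul] at h1
    calc m * (c * k) = L * (k * (c / L * m)) := by field_simp
      _ ≤ L * S.Upsilon xs 1 := by gcongr

end AdaBB

open scoped RealInnerProductSpace in
/-- Theorem 3.10 (pointwise convergence of AdaBB): the sequence `{x^k}` converges to a
minimizer of `f`, and for every `k ≥ 1`,
`min_{1 ≤ i ≤ k} ‖∇f(x^i)‖² ≤ L·Υ_1/(c·k)` where `c = min{α_0, 1/(√2·L)}`. -/
theorem adabb_pointwise_convergence (n : ℕ) (S : AdaBB n)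
    (xs : EuclideanSpace ℝ (Fin n)) (hxs : ∀ y, S.f xs ≤ S.f y)
    (R : ℝ) (hR0 : 0 ≤ R)
    (hR2 : R ^ 2 = ‖S.x 0 - xs‖ ^ 2 + S.α 0 ^ 2 * (1 + 2 * S.M 1) * ‖S.f' (S.x 0)‖ ^ 2 +
      max (2 * S.P 1 - 2 * S.α 0) 0 * (S.f (S.x 0) - S.f xs))
    (L : ℝ) (hL : 0 < L)
    (hsmooth : ∀ x y : EuclideanSpace ℝ (Fin n), ‖x - xs‖ ≤ R → ‖y - xs‖ ≤ R →
      (1 / (2 * L)) * ‖S.f' x - S.f' y‖ ^ 2 ≤ S.f x - S.f y - ⟪S.f' y, x - y⟫)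
    (hcoco : ∀ x y : EuclideanSpace ℝ (Fin n), ‖x - xs‖ ≤ R → ‖y - xs‖ ≤ R →
      (1 / L) * ‖S.f' x - S.f' y‖ ^ 2 ≤ ⟪S.f' x - S.f' y, x - y⟫) :
    (∃ z, (∀ y, S.f z ≤ S.f y) ∧ Filter.Tendsto S.x Filter.atTop (nhds z)) ∧
    ∀ k : ℕ, ∀ hk : 1 ≤ k,
      (Finset.Icc 1 k).inf' (Finset.nonempty_Icc.mpr hk) (fun i => ‖S.f' (S.x i)‖ ^ 2) ≤
        L * S.Upsilon xs 1 / (min (S.α 0) (1 / (Real.sqrt 2 * L)) * (k : ℝ)) := by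
  exact S.main xs hxs R hR0 hR2 L hL hsmooth hcoco
end

section
/- Linear convergence of the strongly-convex variant of AdaBB: the sequence {x^k} converges linearly to the unique minimizer x* of f; that is, there exist C > 0 and ρ ∈ (0,1) such that ‖x^k − x*‖² ≤ C·ρ^k for all k ≥ 1. -/
open scoped RealInnerProductSpace
open Finset Filter

noncomputable section

/-- The strongly-convex variant of the AdaBB iteration (stepsize rule (5.2) of the paper),
with parameters `η ∈ [0,1)` and `δ ∈ (1,2)`, for a convex differentiable function
`f : ℝⁿ → ℝ` with gradient `f'` that attains its minimum. -/
structure AdaBBSC (n : ℕ) where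
  η : ℝ
  δ : ℝ
  hη0 : 0 ≤ η
  hη1 : η < 1
  hδ1 : 1 < δ
  hδ2 : δ < 2
  f : EuclideanSpace ℝ (Fin n) → ℝ
  f' : EuclideanSpace ℝ (Fin n) → EuclideanSpace ℝ (Fin n)
  x : ℕ → EuclideanSpace ℝ (Fin n)
  α : ℕ → ℝ
  θ : ℕ → ℝ
  lam : ℕ → ℝ
  hconv : ConvexOn ℝ Set.univ f
  hgrad : ∀ y, HasGradientAt f (f' y) y
  hmin : ∃ z, ∀ y, f z ≤ f y
  hα0 : 0 < α 0
  hθ0 : 0 ≤ θ 0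
  hx1 : x 1 = x 0 - α 0 • f' (x 0)
  hne : ∀ k, f' (x (k + 1)) ≠ f' (x k)
  hlam : ∀ k, lam (k + 1) =
    ⟪f' (x (k + 1)) - f' (x k), x (k + 1) - x k⟫ / ‖f' (x (k + 1)) - f' (x k)‖ ^ 2
  hlampos : ∀ k, 0 < lam (k + 1)
  hcase1 : ∀ k, α k ≤ lam (k + 1) →
    α (k + 1) = min (Real.sqrt (1 + η * θ k) * α k) (lam (k + 1)) ∧
    θ (k + 1) = α (k + 1) / α k
  hcase2 : ∀ k, δ * α k / 2 < lam (k + 1) → lam (k + 1) < α k →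
    α (k + 1) = lam (k + 1) ∧ θ (k + 1) = 2 * α (k + 1) / α k - 1
  hcase3 : ∀ k, lam (k + 1) ≤ δ * α k / 2 →
    α (k + 1) = lam (k + 1) / Real.sqrt 2 ∧ θ (k + 1) = α (k + 1) / α k
  hstep : ∀ k, x (k + 2) = x (k + 1) - α (k + 1) • f' (x (k + 1))

namespace AdaBBSC

variable {n : ℕ}

/-- `M_k` (for `k ≥ 1`), as in (5.4). -/
def M (S : AdaBBSC n) (k : ℕ) : ℝ :=
  if S.α (k - 1) ≤ S.lam k then 0
  else if S.δ * S.α (k - 1) / 2 < S.lam k then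
    S.α k / S.α (k - 1) - S.α k ^ 2 / S.α (k - 1) ^ 2
  else 1 / 2 - S.lam k / (2 * S.α (k - 1))

/-- `P_k` for `k ≥ 1`, as in (5.4). -/
def Paux (S : AdaBBSC n) (k : ℕ) : ℝ :=
  if S.α (k - 1) ≤ S.lam k then S.α k ^ 2 / S.α (k - 1)
  else if S.δ * S.α (k - 1) / 2 < S.lam k then 2 * S.α k ^ 2 / S.α (k - 1) - S.α k
  else S.α k ^ 2 / S.α (k - 1)

/-- `P_k`, with the convention `P_0 = (P_1 - α_0)/η` if `η ∈ (0,1)` and `P_0 = 0` if `η = 0`. -/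
def P (S : AdaBBSC n) (k : ℕ) : ℝ :=
  if k = 0 then (if S.η = 0 then 0 else (S.Paux 1 - S.α 0) / S.η) else S.Paux k

end AdaBBSC

end

namespace AdaBBSC

variable {n : ℕ} (S : AdaBBSC n)

/-- The three branches of the stepsize rule, with the resulting values. -/
lemma branches (k : ℕ) :
    (S.α k ≤ S.lam (k+1) ∧ S.α (k+1) = min (Real.sqrt (1 + S.η * S.θ k) * S.α k) (S.lam (k+1)) ∧
      S.θ (k+1) = S.α (k+1) / S.α k ∧ S.M (k+1) = 0 ∧ S.P (k+1) = S.α (k+1)^2 / S.α k) ∨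
    (S.δ * S.α k / 2 < S.lam (k+1) ∧ S.lam (k+1) < S.α k ∧ S.α (k+1) = S.lam (k+1) ∧
      S.θ (k+1) = 2 * S.α (k+1) / S.α k - 1 ∧
      S.M (k+1) = S.α (k+1) / S.α k - S.α (k+1)^2 / S.α k ^2 ∧
      S.P (k+1) = 2 * S.α (k+1)^2 / S.α k - S.α (k+1)) ∨
    (S.lam (k+1) < S.α k ∧ S.lam (k+1) ≤ S.δ * S.α k / 2 ∧
      S.α (k+1) = S.lam (k+1) / Real.sqrt 2 ∧ S.θ (k+1) = S.α (k+1) / S.α k ∧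
      S.M (k+1) = 1/2 - S.lam (k+1) / (2 * S.α k) ∧ S.P (k+1) = S.α (k+1)^2 / S.α k) := by
  by_cases h1 : S.α k ≤ S.lam (k+1)
  · left
    exact ⟨h1, (S.hcase1 k h1).1, (S.hcase1 k h1).2, by simp [M, h1], by simp [P, Paux, h1]⟩
  · by_cases h2 : S.δ * S.α k / 2 < S.lam (k+1)
    · right; left
      have h1' := not_le.1 h1
      exact ⟨h2, h1', (S.hcase2 k h2 h1').1, (S.hcase2 k h2 h1').2, by simp [M, h1, h2],
        by simp [P, Paux, h1, h2]⟩
    · right; right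
      have h2' := not_lt.1 h2
      exact ⟨not_le.1 h1, h2', (S.hcase3 k h2').1, (S.hcase3 k h2').2, by simp [M, h1, h2],
        by simp [P, Paux, h1, h2]⟩

lemma pos (k : ℕ) : 0 < S.α k ∧ 0 ≤ S.θ k := by
  induction k with
  | zero => exact ⟨S.hα0, S.hθ0⟩
  | succ k ih =>
    obtain ⟨ha, ht⟩ := ih
    have hl := S.hlampos k
    rcases S.branches k with ⟨h, e, t, -, -⟩ | ⟨h, h', e, t, -, -⟩ | ⟨-, h, e, t, -, -⟩
    · have : 0 < S.α (k+1) := by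
        rw [e]
        have := mul_nonneg S.hη0 ht
        exact lt_min (by positivity) hl
      exact ⟨this, by rw [t]; positivity⟩
    · have hb : 0 < S.α (k+1) := by rw [e]; exact hl
      refine ⟨hb, ?_⟩
      rw [t, sub_nonneg, le_div_iff₀ ha]
      nlinarith [S.hδ1]
    · have hb : 0 < S.α (k+1) := by rw [e]; positivity
      exact ⟨hb, by rw [t]; positivity⟩

lemma P_eq (k : ℕ) : S.P (k+1) = S.θ (k+1) * S.α (k+1) := by
  have ha := (S.pos k).1
  rcases S.branches k with ⟨h, e, t, -, p⟩ | ⟨h, h', e, t, -, p⟩ | ⟨-, h, e, t, -, p⟩ <;>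
  · rw [p, t]; field_simp

lemma P_nonneg (k : ℕ) : 0 ≤ S.P (k+1) := by
  rw [P_eq]; exact mul_nonneg (S.pos _).2 (S.pos _).1.le

lemma alpha3_sq (k : ℕ) (e : S.α (k+1) = S.lam (k+1) / Real.sqrt 2) :
    2 * S.α (k+1)^2 = S.lam (k+1)^2 := by
  rw [e, div_pow, Real.sq_sqrt (by norm_num)]; ring

lemma P_step (k : ℕ) : S.P (k+2) ≤ S.α (k+1) + S.P (k+1) := by
  have hb := (S.pos (k+1)).1
  have ht := (S.pos (k+1)).2
  have hP := S.P_nonneg k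
  rcases S.branches (k+1) with ⟨h, e, t, -, p⟩ | ⟨h, h', e, t, -, p⟩ | ⟨h', h, e, t, -, p⟩
  · rw [p, div_le_iff₀ hb]
    have hη := mul_nonneg S.hη0 ht
    have h1 : S.α (k+1+1) ≤ Real.sqrt (1 + S.η * S.θ (k+1)) * S.α (k+1) := by
      rw [e]; exact min_le_left _ _
    have h2 : S.α (k+1+1)^2 ≤ (Real.sqrt (1 + S.η * S.θ (k+1)) * S.α (k+1))^2 :=
      pow_le_pow_left₀ (S.pos _).1.le h1 2
    rw [mul_pow, Real.sq_sqrt (by linarith)] at h2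
    have h3 : S.η * S.θ (k+1) ≤ S.θ (k+1) := by nlinarith [S.hη1]
    rw [P_eq]
    nlinarith [mul_le_mul_of_nonneg_right h3 (sq_nonneg (S.α (k+1)))]
  · have hc := (S.pos (k+1+1)).1
    have : 2 * S.α (k+1+1)^2 / S.α (k+1) ≤ 2 * S.α (k+1+1) := by
      rw [div_le_iff₀ hb]; nlinarith
    rw [p]; linarith
  · have h2 := S.alpha3_sq (k+1) e
    have hl := S.hlampos (k+1)
    rw [p, div_le_iff₀ hb]
    nlinarith

lemma M_bounds (k : ℕ) : 0 ≤ S.M (k+1) ∧ S.M (k+1) ≤ 1/2 := by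
  have ha := (S.pos k).1
  have hl := S.hlampos k
  rcases S.branches k with ⟨h, e, t, m, p⟩ | ⟨h, h', e, t, m, p⟩ | ⟨h', h, e, t, m, p⟩
  · rw [m]; norm_num
  · rw [m, e, ← div_pow]
    have h1 : S.lam (k+1) / S.α k ≤ 1 := by rw [div_le_one ha]; exact h'.le
    have h0 : 0 ≤ S.lam (k+1) / S.α k := by positivity
    constructor <;> nlinarith [sq_nonneg (S.lam (k+1) / S.α k - 1/2)]
  · rw [m]
    have h1 : S.lam (k+1) / (2 * S.α k) ≤ 1/2 := by
      rw [div_le_div_iff₀ (by positivity) (by norm_num)]; linarith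
    have h0 : 0 ≤ S.lam (k+1) / (2 * S.α k) := by positivity
    constructor <;> linarith

lemma grad_ineq (x y : EuclideanSpace ℝ (Fin n)) : S.f x + ⟪S.f' x, y - x⟫ ≤ S.f y := by
  have hc : ConvexOn ℝ Set.univ (S.f ∘ (AffineMap.lineMap x y : ℝ →ᵃ[ℝ] _)) := by
    simpa using S.hconv.comp_affineMap (AffineMap.lineMap x y : ℝ →ᵃ[ℝ] _)
  have hd : HasDerivAt (S.f ∘ (AffineMap.lineMap x y : ℝ →ᵃ[ℝ] _)) ⟪S.f' x, y - x⟫ 0 := by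
    have h1 : HasFDerivAt S.f (InnerProductSpace.toDual ℝ _ (S.f' x))
        ((AffineMap.lineMap x y : ℝ →ᵃ[ℝ] _) (0:ℝ)) := by
      simpa using (S.hgrad x).hasFDerivAt
    have h2 : HasDerivAt (AffineMap.lineMap x y : ℝ →ᵃ[ℝ] _) (y - x) (0:ℝ) :=
      AffineMap.hasDerivAt_lineMap
    simpa using h1.comp_hasDerivAt (0:ℝ) h2
  have := hc.le_slope_of_hasDerivAt (Set.mem_univ 0) (Set.mem_univ 1) zero_lt_one hd
  simp [slope_def_field] at this
  linarith

lemma step (k : ℕ) : S.x (k+1) = S.x k - S.α k • S.f' (S.x k) := by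
  cases k with
  | zero => exact S.hx1
  | succ k => exact S.hstep k

/-- The scalar identity encoded by the definition of `lam`. -/
lemma lam_id (k : ℕ) :
    S.α k * (‖S.f' (S.x k)‖^2 - ⟪S.f' (S.x (k+1)), S.f' (S.x k)⟫) =
      S.lam (k+1) * ‖S.f' (S.x (k+1)) - S.f' (S.x k)‖^2 := by
  have hD : ‖S.f' (S.x (k+1)) - S.f' (S.x k)‖^2 ≠ 0 := by
    have := norm_pos_iff.2 (sub_ne_zero.2 (S.hne k))
    positivity
  have h1 : S.x (k+1) - S.x k = - (S.α k • S.f' (S.x k)) := by rw [S.step k]; abel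
  rw [S.hlam k, div_mul_cancel₀ _ hD, h1, inner_neg_right, inner_smul_right, inner_sub_left,
    real_inner_self_eq_norm_sq]
  ring

lemma key (k : ℕ) :
    2 * S.α (k+1)^2 * ‖S.f' (S.x (k+1))‖^2 ≤
      2 * S.M (k+1) * S.α k ^2 * ‖S.f' (S.x k)‖^2 +
        2 * S.P (k+1) * (S.f (S.x k) - S.f (S.x (k+1))) := by
  have ha := (S.pos k).1
  have hb := (S.pos (k+1)).1
  have hl := S.hlampos k
  have hP := S.P_nonneg k
  have hid := S.lam_id k
  have hg := S.grad_ineq (S.x (k+1)) (S.x k)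
  have h1 : S.x k - S.x (k+1) = S.α k • S.f' (S.x k) := by rw [S.step k]; abel
  rw [h1, inner_smul_right] at hg
  have hCS := abs_real_inner_le_norm (S.f' (S.x (k+1))) (S.f' (S.x k))
  have hD0 := sq_nonneg ‖S.f' (S.x (k+1)) - S.f' (S.x k)‖
  rw [norm_sub_sq_real] at hid hD0
  have hCS2 : ⟪S.f' (S.x (k+1)), S.f' (S.x k)⟫^2 ≤
      ‖S.f' (S.x (k+1))‖^2 * ‖S.f' (S.x k)‖^2 := by
    rw [← mul_pow, ← sq_abs]; exact pow_le_pow_left₀ (abs_nonneg _) hCS 2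
  have hA := sq_nonneg ‖S.f' (S.x k)‖
  have hB := sq_nonneg ‖S.f' (S.x (k+1))‖
  have hbr := S.branches k
  have h3 := S.alpha3_sq k
  have hfP : 2 * S.P (k+1) * (S.α k * ⟪S.f' (S.x (k+1)), S.f' (S.x k)⟫) ≤
      2 * S.P (k+1) * (S.f (S.x k) - S.f (S.x (k+1))) :=
    mul_le_mul_of_nonneg_left (by linarith) (by positivity)
  refine le_trans ?_ (add_le_add_right hfP _)
  clear hfP hg h1 hCS
  generalize ‖S.f' (S.x (k+1))‖^2 = B at *
  generalize ‖S.f' (S.x k)‖^2 = A at *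
  generalize ⟪S.f' (S.x (k+1)), S.f' (S.x k)⟫ = c at *
  generalize S.M (k+1) = m at *
  generalize S.P (k+1) = p at *
  generalize S.lam (k+1) = l at *
  generalize S.α (k+1) = b at *
  generalize S.α k = a at *
  rcases hbr with ⟨h, e, t, rfl, rfl⟩ | ⟨h, h', rfl, t, rfl, rfl⟩ | ⟨h', h, e, t, rfl, rfl⟩
  · have hBc : B ≤ c := by
      have : a * (B - 2 * c + A) ≤ a * (A - c) := by rw [hid]; exact mul_le_mul_of_nonneg_right h hD0
      have := le_of_mul_le_mul_left this ha
      linarith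
    have : 2 * (b^2/a) * (a * c) = 2 * b^2 * c := by field_simp
    rw [this]
    nlinarith [mul_le_mul_of_nonneg_left hBc (sq_nonneg b)]
  · apply le_of_eq
    have e1 : b * B = (a - b) * A + (2 * b - a) * c := by linarith
    have : 2 * (b / a - b ^ 2 / a ^ 2) * a ^ 2 * A + 2 * (2 * b ^ 2 / a - b) * (a * c)
      = 2 * b * ((a - b) * A + (2 * b - a) * c) := by field_simp
    rw [this, ← e1]; ring
  · have h3 := h3 e
    have e1 : l * B = (a - l) * A + (2 * l - a) * c := by linarith
    have : 2 * (1 / 2 - l / (2 * a)) * a ^ 2 * A + 2 * (b^2 / a) * (a * c)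
      = (a - l) * a * A + l^2 * c := by rw [← h3]; field_simp
    rw [this, h3]
    have hQ : 0 ≤ (a - l) * A + l * c := by
      by_contra hneg
      push Not at hneg
      have q1 : (a - l) * A < l * (-c) := by linarith
      have q2 : l * B < (a - l) * (-c) := by nlinarith
      have h4 : 0 < a - l := by linarith
      have hc : 0 < -c := by
        by_contra hc
        push Not at hc
        nlinarith [mul_nonneg h4.le hA]
      have q3 : ((a - l) * A) * (l * B) < (l * (-c)) * ((a - l) * (-c)) :=
        mul_lt_mul'' q1 q2 (by positivity) (by positivity)
      have : l * (a - l) * (B * A) < l * (a-l) * c^2 := by nlinarith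
      have := lt_of_mul_lt_mul_left this (by positivity)
      linarith
    have : (a - l) * a * A + l^2 * c - l^2 * B = (a - l) * ((a - l) * A + l * c) := by
      linear_combination (-l) * e1
    nlinarith [mul_nonneg (sub_nonneg.2 h'.le) hQ]

/-- The Lyapunov function. -/
noncomputable def E (xs : EuclideanSpace ℝ (Fin n)) (k : ℕ) : ℝ :=
  ‖S.x (k+1) - xs‖^2 + 2 * S.M (k+1) * S.α k^2 * ‖S.f' (S.x k)‖^2 +
    2 * S.P (k+1) * (S.f (S.x k) - S.f xs)

lemma dist_step (xs : EuclideanSpace ℝ (Fin n)) (k : ℕ) :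
    ‖S.x (k+1) - xs‖^2 ≤ ‖S.x k - xs‖^2 - 2 * S.α k * (S.f (S.x k) - S.f xs) +
      S.α k^2 * ‖S.f' (S.x k)‖^2 := by
  have ha := (S.pos k).1
  have hg := S.grad_ineq (S.x k) xs
  have h1 : S.x (k+1) - xs = (S.x k - xs) - S.α k • S.f' (S.x k) := by rw [S.step k]; abel
  have h2 : ⟪S.f' (S.x k), xs - S.x k⟫ = - ⟪S.x k - xs, S.f' (S.x k)⟫ := by
    rw [real_inner_comm, ← inner_neg_left, neg_sub]
  rw [h1, norm_sub_sq_real, inner_smul_right, norm_smul, mul_pow, Real.norm_eq_abs, sq_abs]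
  rw [h2] at hg
  nlinarith [mul_le_mul_of_nonneg_left hg ha.le]

lemma E_step (xs : EuclideanSpace ℝ (Fin n)) (hxs : ∀ y, S.f xs ≤ S.f y) (k : ℕ) :
    S.E xs (k+1) + (1 - 2 * S.M (k+2)) * S.α (k+1)^2 * ‖S.f' (S.x (k+1))‖^2 ≤ S.E xs k := by
  have h1 := S.dist_step xs (k+1)
  have h2 := S.key k
  have h3 := mul_le_mul_of_nonneg_right (S.P_step k) (sub_nonneg.2 (hxs (S.x (k+1))))
  simp only [E, add_assoc, Nat.reduceAdd] at *
  nlinarith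

lemma E_nonneg_part (xs : EuclideanSpace ℝ (Fin n)) (hxs : ∀ y, S.f xs ≤ S.f y) (k : ℕ) :
    ‖S.x (k+1) - xs‖^2 ≤ S.E xs k := by
  have h1 := (S.M_bounds k).1
  have h2 := S.P_nonneg k
  have h3 := sub_nonneg.2 (hxs (S.x k))
  unfold E
  have : 0 ≤ 2 * S.M (k+1) * S.α k^2 * ‖S.f' (S.x k)‖^2 := by positivity
  have : 0 ≤ 2 * S.P (k+1) * (S.f (S.x k) - S.f xs) := by positivity
  linarith

lemma E_anti (xs : EuclideanSpace ℝ (Fin n)) (hxs : ∀ y, S.f xs ≤ S.f y) (k : ℕ) :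
    S.E xs k ≤ S.E xs 0 := by
  induction k with
  | zero => exact le_rfl
  | succ k ih =>
    have h := S.E_step xs hxs k
    have hM : 0 ≤ 1 - 2 * S.M (k+2) := by linarith [(S.M_bounds (k+1)).2]
    have : 0 ≤ (1 - 2 * S.M (k+2)) * S.α (k+1)^2 * ‖S.f' (S.x (k+1))‖^2 := by positivity
    linarith

end AdaBBSC

open scoped RealInnerProductSpace in
/-- Theorem 5.4 (linear convergence of the strongly-convex variant of AdaBB): the sequence
`{x^k}` converges linearly to the unique minimizer `x*` of `f`: there exist `C > 0` and
`ρ ∈ (0,1)` such that `‖x^k - x*‖² ≤ C·ρ^k` for all `k ≥ 1`. -/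
theorem adabbsc_linear_convergence (n : ℕ) (S : AdaBBSC n)
    (xs : EuclideanSpace ℝ (Fin n)) (hxs : ∀ y, S.f xs ≤ S.f y)
    (R : ℝ) (hR0 : 0 ≤ R)
    (hR2 : R ^ 2 = ‖S.x 0 - xs‖ ^ 2 + S.α 0 ^ 2 * (1 + 2 * S.M 1) * ‖S.f' (S.x 0)‖ ^ 2 +
      max (2 * S.P 1 - 2 * S.α 0) 0 * (S.f (S.x 0) - S.f xs))
    (μ L : ℝ) (hμ : 0 < μ) (hμL : μ ≤ L)
    (hstrong : ∀ x y : EuclideanSpace ℝ (Fin n), ‖x - xs‖ ≤ R → ‖y - xs‖ ≤ R →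
      μ / 2 * ‖x - y‖ ^ 2 ≤ S.f x - S.f y - ⟪S.f' y, x - y⟫)
    (hsmooth : ∀ x y : EuclideanSpace ℝ (Fin n), ‖x - xs‖ ≤ R → ‖y - xs‖ ≤ R →
      (1 / (2 * L)) * ‖S.f' x - S.f' y‖ ^ 2 ≤ S.f x - S.f y - ⟪S.f' y, x - y⟫)
    (hcoco : ∀ x y : EuclideanSpace ℝ (Fin n), ‖x - xs‖ ≤ R → ‖y - xs‖ ≤ R →
      (1 / L) * ‖S.f' x - S.f' y‖ ^ 2 ≤ ⟪S.f' x - S.f' y, x - y⟫)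
    (hsc : ∀ x y : EuclideanSpace ℝ (Fin n), ‖x - xs‖ ≤ R → ‖y - xs‖ ≤ R →
      ⟪S.f' x - S.f' y, x - y⟫ ≤ (1 / μ) * ‖S.f' x - S.f' y‖ ^ 2) :
    ∃ C > 0, ∃ ρ ∈ Set.Ioo (0 : ℝ) 1, ∀ k : ℕ, 1 ≤ k → ‖S.x k - xs‖ ^ 2 ≤ C * ρ ^ k := by
  have hL : 0 < L := lt_of_lt_of_le hμ hμL
  have hE0 : S.E xs 0 ≤ R ^ 2 := by
    have h1 := S.dist_step xs 0
    have h2 := mul_le_mul_of_nonneg_right (le_max_left (2 * S.P 1 - 2 * S.α 0) 0)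
      (sub_nonneg.2 (hxs (S.x 0)))
    simp only [AdaBBSC.E, zero_add] at *
    nlinarith
  have hball : ∀ k, ‖S.x k - xs‖ ≤ R := by
    intro k
    refine (sq_le_sq₀ (norm_nonneg _) hR0).1 ?_
    cases k with
    | zero =>
      have h1 := (S.M_bounds 0).1
      have h2 := mul_nonneg (le_max_right (2 * S.P 1 - 2 * S.α 0) 0)
        (sub_nonneg.2 (hxs (S.x 0)))
      simp only [zero_add] at h1
      have h3 : 0 ≤ S.α 0 ^ 2 * (1 + 2 * S.M 1) * ‖S.f' (S.x 0)‖ ^ 2 := by positivity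
      linarith
    | succ k => exact (S.E_nonneg_part xs hxs k).trans ((S.E_anti xs hxs k).trans hE0)
  have hlamB : ∀ k, 1 / L ≤ S.lam (k+1) ∧ S.lam (k+1) ≤ 1 / μ := by
    intro k
    have hD : 0 < ‖S.f' (S.x (k+1)) - S.f' (S.x k)‖^2 := by
      have := norm_pos_iff.2 (sub_ne_zero.2 (S.hne k))
      positivity
    rw [S.hlam k, le_div_iff₀ hD, div_le_iff₀ hD]
    exact ⟨hcoco _ _ (hball _) (hball _), hsc _ _ (hball _) (hball _)⟩
  have hup : ∀ k, S.α (k+1) ≤ 1 / μ := by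
    intro k
    refine le_trans ?_ (hlamB k).2
    rcases S.branches k with ⟨h, e, -⟩ | ⟨-, -, e, -⟩ | ⟨-, -, e, -⟩
    · rw [e]; exact min_le_right _ _
    · exact e.le
    · rw [e]
      exact div_le_self (S.hlampos k).le (Real.one_le_sqrt.2 (by norm_num))
  obtain ⟨m, hm0, hmL, hm⟩ : ∃ m : ℝ, 0 < m ∧ m ≤ 1 / (2 * L) ∧ ∀ k, m ≤ S.α k := by
    refine ⟨min (S.α 0) (1 / (2*L)), lt_min S.hα0 (by positivity), min_le_right _ _, ?_⟩
    intro k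
    induction k with
    | zero => exact min_le_left _ _
    | succ k ih =>
      have ha := (S.pos k).1
      have h2L : 1 / (2 * L) = (1 / L) / 2 := by field_simp
      have hl := (hlamB k).1
      have hLp : 0 < 1 / L := by positivity
      rcases S.branches k with ⟨h, e, -⟩ | ⟨-, -, e, -⟩ | ⟨-, -, e, -⟩
      · refine ih.trans ?_
        rw [e]
        refine le_min ?_ h
        have : 1 ≤ Real.sqrt (1 + S.η * S.θ k) :=
          Real.one_le_sqrt.2 (by nlinarith [mul_nonneg S.hη0 (S.pos k).2])
        nlinarith
      · refine (min_le_right _ _).trans ?_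
        rw [e, h2L]; linarith
      · refine (min_le_right _ _).trans ?_
        rw [e, h2L]
        have h2 : Real.sqrt 2 ≤ 2 := by
          rw [Real.sqrt_le_left (by norm_num)]; norm_num
        exact div_le_div₀ (by linarith) hl (by positivity) h2
  have hslack : ∀ k, m^2/2 ≤ (1 - 2 * S.M (k+1)) * S.α k^2 := by
    intro k
    have ha := (S.pos k).1
    have hma := hm k
    have hsq : m^2 ≤ S.α k^2 := pow_le_pow_left₀ hm0.le hma 2
    rcases S.branches k with ⟨-, -, -, e, -⟩ | ⟨-, -, -, -, e, -⟩ | ⟨-, -, -, -, e, -⟩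
    · rw [e]; nlinarith
    · rw [e, ← div_pow]
      have : 1/2 ≤ 1 - 2 * (S.α (k+1) / S.α k - (S.α (k+1) / S.α k)^2) := by
        nlinarith [sq_nonneg (S.α (k+1) / S.α k - 1/2)]
      nlinarith [mul_le_mul_of_nonneg_right this (sq_nonneg (S.α k))]
    · have : (1 - 2 * S.M (k+1)) * S.α k^2 = S.lam (k+1) * S.α k := by rw [e]; field_simp; ring
      rw [this]
      have hl := (hlamB k).1
      have h2L : 1 / (2 * L) = (1 / L) / 2 := by field_simp
      have : m ≤ S.lam (k+1) := by
        have : 0 < 1 / L := by positivity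
        linarith
      nlinarith [mul_le_mul this hma hm0.le (S.hlampos k).le]
  have hPup : ∀ k, S.P (k+1) ≤ 2 * (1/μ)^2 / m := by
    intro k
    have ha := (S.pos k).1
    have hb := (S.pos (k+1)).1
    have h1 : S.P (k+1) ≤ 2 * S.α (k+1)^2 / S.α k := by
      have h0 : 0 ≤ S.α (k+1)^2 / S.α k := by positivity
      have h2 : 2 * S.α (k+1)^2 / S.α k = 2 * (S.α (k+1)^2 / S.α k) := by ring
      rcases S.branches k with ⟨-, -, -, -, e⟩ | ⟨-, -, -, -, -, e⟩ | ⟨-, -, -, -, -, e⟩ <;>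
      · rw [e]; linarith
    refine h1.trans ?_
    have := pow_le_pow_left₀ hb.le (hup k) 2
    exact div_le_div₀ (by positivity) (by linarith) hm0 (hm k)
  have hg0 : S.f' xs = 0 := by
    have h1 : IsLocalMin S.f xs := Filter.Eventually.of_forall hxs
    have := h1.hasFDerivAt_eq_zero (S.hgrad xs).hasFDerivAt
    simpa using this
  have hxsR : ‖xs - xs‖ ≤ R := by simpa using hR0
  have hPL : ∀ k, ‖S.x k - xs‖ ≤ 1 / μ * ‖S.f' (S.x k)‖ ∧
      S.f (S.x k) - S.f xs ≤ 1 / μ * ‖S.f' (S.x k)‖^2 := by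
    intro k
    have h1 := hstrong (S.x k) xs (hball k) hxsR
    have h2 := hstrong xs (S.x k) hxsR (hball k)
    rw [hg0, inner_zero_left] at h1
    have h3 : ⟪S.f' (S.x k), xs - S.x k⟫ = - ⟪S.f' (S.x k), S.x k - xs⟫ := by
      rw [← inner_neg_right, neg_sub]
    rw [norm_sub_rev, h3] at h2
    have h4 := real_inner_le_norm (S.f' (S.x k)) (S.x k - xs)
    have hd : ‖S.x k - xs‖ ≤ 1 / μ * ‖S.f' (S.x k)‖ := by
      rw [one_div, inv_mul_eq_div, le_div_iff₀ hμ]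
      rcases (norm_nonneg (S.x k - xs)).eq_or_lt with h0 | h0
      · rw [← h0]; simp
      · refine le_of_mul_le_mul_right (?_ : _ ≤ ‖S.f' (S.x k)‖ * ‖S.x k - xs‖) h0
        nlinarith
    refine ⟨hd, ?_⟩
    have h5 := mul_le_mul_of_nonneg_left hd (norm_nonneg (S.f' (S.x k)))
    have h6 : 0 ≤ μ / 2 * ‖S.x k - xs‖ ^ 2 := by positivity
    nlinarith
  obtain ⟨K, hK0, hK⟩ : ∃ K : ℝ, 0 < K ∧ ∀ k, S.E xs (k+1) ≤ K * ‖S.f' (S.x (k+1))‖^2 := by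
    refine ⟨(2 * (1/μ))^2 + (1/μ)^2 + 2 * (2 * (1/μ)^2 / m) * (1/μ), by positivity, ?_⟩
    intro k
    have hb := (S.pos (k+1)).1
    have hup := hup k
    obtain ⟨hd, hf⟩ := hPL (k+1)
    have hG := sq_nonneg ‖S.f' (S.x (k+1))‖
    have t1 : ‖S.x (k+1+1) - xs‖^2 ≤ (2 * (1/μ))^2 * ‖S.f' (S.x (k+1))‖^2 := by
      rw [← mul_pow]
      refine pow_le_pow_left₀ (norm_nonneg _) ?_ 2
      have h1 : S.x (k+1+1) - xs = (S.x (k+1) - xs) - S.α (k+1) • S.f' (S.x (k+1)) := by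
        rw [S.step (k+1)]; abel
      have h2 := norm_sub_le (S.x (k+1) - xs) (S.α (k+1) • S.f' (S.x (k+1)))
      rw [norm_smul, Real.norm_eq_abs, abs_of_pos hb] at h2
      rw [h1]
      nlinarith [mul_le_mul_of_nonneg_right hup (norm_nonneg (S.f' (S.x (k+1))))]
    have t2 : 2 * S.M (k+1+1) * S.α (k+1)^2 * ‖S.f' (S.x (k+1))‖^2 ≤
        (1/μ)^2 * ‖S.f' (S.x (k+1))‖^2 := by
      refine mul_le_mul_of_nonneg_right ?_ hG
      have h1 := pow_le_pow_left₀ hb.le hup 2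
      have h2 := mul_le_mul_of_nonneg_right (S.M_bounds (k+1)).2 (sq_nonneg (S.α (k+1)))
      linarith
    have t3 : 2 * S.P (k+1+1) * (S.f (S.x (k+1)) - S.f xs) ≤
        2 * (2 * (1/μ)^2 / m) * (1 / μ * ‖S.f' (S.x (k+1))‖^2) :=
      mul_le_mul (by linarith [hPup (k+1)]) hf (sub_nonneg.2 (hxs _)) (by positivity)
    unfold AdaBBSC.E
    linarith
  have hε : 0 < m^2/2 := by positivity
  set ε := m^2/2
  have hcontr : ∀ k, S.E xs (k+1) ≤ K / (K + ε) * S.E xs k := by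
    intro k
    have h1 := S.E_step xs hxs k
    have h2 := hK k
    have h3 := mul_le_mul_of_nonneg_right (hslack (k+1)) (sq_nonneg ‖S.f' (S.x (k+1))‖)
    rw [div_mul_eq_mul_div, le_div_iff₀ (by positivity)]
    have h4 : S.E xs (k+1) + ε * ‖S.f' (S.x (k+1))‖^2 ≤ S.E xs k := le_trans (by linarith) h1
    nlinarith [mul_le_mul_of_nonneg_left h4 hK0.le, mul_le_mul_of_nonneg_left h2 hε.le]
  set ρ := K / (K + ε) with hρ
  have hρ0 : 0 < ρ := by positivity
  have hρ1 : ρ < 1 := by rw [hρ, div_lt_one (by positivity)]; linarith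
  have hEk : ∀ k, S.E xs k ≤ S.E xs 0 * ρ^k := by
    intro k
    induction k with
    | zero => simp
    | succ k ih =>
      refine (hcontr k).trans ?_
      rw [pow_succ]
      nlinarith [mul_le_mul_of_nonneg_left ih hρ0.le]
  have hE00 : 0 ≤ S.E xs 0 := le_trans (sq_nonneg _) (S.E_nonneg_part xs hxs 0)
  refine ⟨S.E xs 0 / ρ + 1, by positivity, ρ, ⟨hρ0, hρ1⟩, ?_⟩
  intro k hk
  obtain ⟨j, rfl⟩ : ∃ j, k = j + 1 := ⟨k - 1, by omega⟩
  refine ((S.E_nonneg_part xs hxs j).trans (hEk j)).trans ?_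
  have : (S.E xs 0 / ρ + 1) * ρ^(j+1) = S.E xs 0 * ρ^j + ρ^(j+1) := by
    rw [pow_succ]; field_simp
  rw [this]
  have : 0 < ρ^(j+1) := by positivity
  linarith
end

section
/- For the AdaPBB iteration and every k ≥ 1: ‖∇f(x^k) + ξ^k‖² ≤ B_k·‖∇f(x^{k−1}) + ξ^{k−1}‖² + E_k·(F(x^{k−1}) − F(x^k)). -/
open scoped RealInnerProductSpace
open Finset Filter

noncomputable section

/-- The AdaPBB iteration (Algorithm 3 of the paper) in its implicit form, for a composite
objective `F = f + g` where `f : ℝⁿ → ℝ` is convex and differentiable with gradient `f'`,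
and `g : ℝⁿ → ℝ` is convex.  `ξ k` is a subgradient of `g` at `x k`. -/
structure AdaPBB (n : ℕ) where
  f : EuclideanSpace ℝ (Fin n) → ℝ
  g : EuclideanSpace ℝ (Fin n) → ℝ
  f' : EuclideanSpace ℝ (Fin n) → EuclideanSpace ℝ (Fin n)
  x : ℕ → EuclideanSpace ℝ (Fin n)
  ξ : ℕ → EuclideanSpace ℝ (Fin n)
  α : ℕ → ℝ
  θ : ℕ → ℝ
  lam : ℕ → ℝ
  hfconv : ConvexOn ℝ Set.univ f
  hgconv : ConvexOn ℝ Set.univ g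
  hgrad : ∀ y, HasGradientAt f (f' y) y
  hmin : ∃ z, ∀ y, f z + g z ≤ f y + g y
  hα0 : 0 < α 0
  hθ0 : 0 ≤ θ 0
  hsub : ∀ k, ∀ y, g (x k) + ⟪ξ k, y - x k⟫ ≤ g y
  hstep : ∀ k, x (k + 1) = x k - α k • (f' (x k) + ξ (k + 1))
  hne : ∀ k, f' (x (k + 1)) ≠ f' (x k)
  hlam : ∀ k, lam (k + 1) =
    ⟪f' (x (k + 1)) - f' (x k), x (k + 1) - x k⟫ / ‖f' (x (k + 1)) - f' (x k)‖ ^ 2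
  hlampos : ∀ k, 0 < lam (k + 1)
  hcase1 : ∀ k, α k ≤ lam (k + 1) →
    α (k + 1) = Real.sqrt (1 + θ k) * α k ∧ θ (k + 1) = α (k + 1) / α k
  hcase2 : ∀ k, α k / 2 < lam (k + 1) → lam (k + 1) < α k →
    α (k + 1) = α k / Real.sqrt 2 ∧ θ (k + 1) = 0
  hcase3 : ∀ k, lam (k + 1) ≤ α k / 2 →
    α (k + 1) = lam (k + 1) / Real.sqrt 2 ∧ θ (k + 1) = 0

namespace AdaPBB

variable {n : ℕ}

/-- The composite objective `F = f + g`. -/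
def F (S : AdaPBB n) (y : EuclideanSpace ℝ (Fin n)) : ℝ := S.f y + S.g y

/-- `B_k` (for `k ≥ 1`), as in (5.13). -/
def B (S : AdaPBB n) (k : ℕ) : ℝ :=
  if S.α (k - 1) ≤ S.lam k then 0
  else if S.α (k - 1) / 2 < S.lam k then 1
  else (S.α (k - 1) - S.lam k) ^ 2 / S.lam k ^ 2

/-- `E_k` for `k ≥ 1`, as in (5.13). -/
def Eaux (S : AdaPBB n) (k : ℕ) : ℝ :=
  if S.α (k - 1) ≤ S.lam k then 1 / S.α (k - 1) else 0

/-- `E_k`, with the convention `E_0 = (E_1·α_1² - α_0)/α_0²`. -/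
def E (S : AdaPBB n) (k : ℕ) : ℝ :=
  if k = 0 then (S.Eaux 1 * S.α 1 ^ 2 - S.α 0) / S.α 0 ^ 2 else S.Eaux k

/-- The energy `V_k` (for `k ≥ 1`), relative to a minimizer `xs` of `F`. -/
def V (S : AdaPBB n) (xs : EuclideanSpace ℝ (Fin n)) (k : ℕ) : ℝ :=
  ‖S.x k - xs‖ ^ 2 + 2 * S.B k * S.α k ^ 2 * ‖S.f' (S.x (k - 1)) + S.ξ (k - 1)‖ ^ 2 +
    2 * S.α (k - 1) * (1 + S.E (k - 1) * S.α (k - 1)) * (S.F (S.x (k - 1)) - S.F xs)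

/-- The energy `U_k` (for `k ≥ 1`), relative to a minimizer `xs` of `F`. -/
def U (S : AdaPBB n) (xs : EuclideanSpace ℝ (Fin n)) (k : ℕ) : ℝ :=
  ‖S.x k - xs‖ ^ 2 + 2 * S.B k * S.α k ^ 2 * ‖S.f' (S.x (k - 1)) + S.ξ (k - 1)‖ ^ 2 +
    2 * S.E k * S.α k ^ 2 * (S.F (S.x (k - 1)) - S.F xs)

end AdaPBB

end
theorem adapbb_grad_ineq {n : ℕ} (S : AdaPBB n) (y z : EuclideanSpace ℝ (Fin n)) :
    S.f y + ⟪S.f' y, z - y⟫ ≤ S.f z := by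
  have hc : ConvexOn ℝ Set.univ (S.f ∘ (AffineMap.lineMap y z : ℝ →ᵃ[ℝ] _)) := by
    simpa using S.hfconv.comp_affineMap (AffineMap.lineMap y z : ℝ →ᵃ[ℝ] _)
  have hd : HasDerivAt (S.f ∘ (AffineMap.lineMap y z : ℝ →ᵃ[ℝ] _)) ⟪S.f' y, z - y⟫ 0 := by
    have h1 := (S.hgrad y).hasFDerivAt
    have h2 : HasDerivAt (AffineMap.lineMap y z : ℝ → _) (z - y) (0 : ℝ) :=
      AffineMap.hasDerivAt_lineMap
    have h3 : HasFDerivAt S.f (InnerProductSpace.toDual ℝ _ (S.f' y))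
        ((AffineMap.lineMap y z : ℝ →ᵃ[ℝ] _) (0 : ℝ)) := by simpa using h1
    simpa using h3.comp_hasDerivAt (0 : ℝ) h2
  have := hc.le_slope_of_hasDerivAt (Set.mem_univ 0) (Set.mem_univ 1) zero_lt_one hd
  simp [slope_def_field] at this
  linarith

theorem adapbb_pos {n : ℕ} (S : AdaPBB n) (k : ℕ) : 0 < S.α k ∧ 0 ≤ S.θ k := by
  induction k with
  | zero => exact ⟨S.hα0, S.hθ0⟩
  | succ k ih =>
    obtain ⟨ha, ht⟩ := ih
    have hl := S.hlampos k
    by_cases h1 : S.α k ≤ S.lam (k + 1)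
    · obtain ⟨e1, e2⟩ := S.hcase1 k h1
      have : 0 < S.α (k + 1) := by rw [e1]; positivity
      exact ⟨this, by rw [e2]; positivity⟩
    · by_cases h2 : S.α k / 2 < S.lam (k + 1)
      · obtain ⟨e1, e2⟩ := S.hcase2 k h2 (not_le.mp h1)
        exact ⟨by rw [e1]; positivity, e2.ge⟩
      · obtain ⟨e1, e2⟩ := S.hcase3 k (not_lt.mp h2)
        exact ⟨by rw [e1]; positivity, e2.ge⟩

/-- Lemma 5.8: for the AdaPBB iteration and every `k ≥ 1`,
`‖∇f(x^k) + ξ^k‖² ≤ B_k·‖∇f(x^{k-1}) + ξ^{k-1}‖² + E_k·(F(x^{k-1}) - F(x^k))`. -/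
theorem adapbb_subgradient_bound (n : ℕ) (S : AdaPBB n) :
    ∀ k : ℕ, 1 ≤ k →
      ‖S.f' (S.x k) + S.ξ k‖ ^ 2 ≤
        S.B k * ‖S.f' (S.x (k - 1)) + S.ξ (k - 1)‖ ^ 2 +
          S.E k * (S.F (S.x (k - 1)) - S.F (S.x k)) := by
  intro k hk
  obtain ⟨k, rfl⟩ : ∃ j, k = j + 1 := ⟨k - 1, by omega⟩
  have ha := (adapbb_pos S k).1
  have hl := S.hlampos k
  have hlam := S.hlam k
  have hstep := S.hstep k
  have hg1 := S.hsub (k + 1) (S.x k)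
  have hg0 := S.hsub k (S.x (k + 1))
  have hf := adapbb_grad_ineq S (S.x (k + 1)) (S.x k)
  have hne := S.hne k
  simp only [AdaPBB.B, AdaPBB.E, AdaPBB.Eaux, AdaPBB.F, Nat.add_sub_cancel,
    Nat.succ_ne_zero, if_false]
  obtain ⟨d, hd⟩ : ∃ d, d = S.f' (S.x (k + 1)) - S.f' (S.x k) := ⟨_, rfl⟩
  obtain ⟨p, hp⟩ : ∃ p, p = S.f' (S.x k) + S.ξ (k + 1) := ⟨_, rfl⟩
  obtain ⟨w, hw⟩ : ∃ w, w = S.f' (S.x k) + S.ξ k := ⟨_, rfl⟩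
  have hu : S.f' (S.x (k + 1)) + S.ξ (k + 1) = p + d := by rw [hd, hp]; abel
  have hx1 : S.x (k + 1) - S.x k = -(S.α k • p) := by rw [hstep, hp]; abel
  have hx0 : S.x k - S.x (k + 1) = S.α k • p := by rw [hstep, hp]; abel
  have hdpos : 0 < ‖d‖ ^ 2 := by
    have : d ≠ 0 := by rw [hd]; exact sub_ne_zero.mpr hne
    positivity
  rw [← hd, hx1, inner_neg_right, inner_smul_right, eq_div_iff hdpos.ne'] at hlam
  rw [hx0, inner_smul_right] at hg1 hf
  rw [hx1, inner_neg_right, inner_smul_right] at hg0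
  -- descent of the intermediate residual
  have hpw : ‖p‖ ^ 2 ≤ ‖w‖ ^ 2 := by
    have e : ⟪w, p⟫ = ⟪p, p⟫ - ⟪S.ξ (k + 1), p⟫ + ⟪S.ξ k, p⟫ := by
      rw [← inner_sub_left, ← inner_add_left, hp, hw]; congr 1; abel
    rw [real_inner_self_eq_norm_sq] at e
    have h1 : S.α k * (⟪S.ξ (k + 1), p⟫ - ⟪S.ξ k, p⟫) ≤ 0 := by linarith
    have h2 : ⟪S.ξ (k + 1), p⟫ - ⟪S.ξ k, p⟫ ≤ 0 := by
      by_contra h; push Not at h; nlinarith [mul_pos ha h]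
    have h3 := norm_sub_sq_real w p
    nlinarith [sq_nonneg ‖w - p‖]
  have hdp : ⟪d, p⟫ = -(S.lam (k + 1) / S.α k) * ‖d‖ ^ 2 := by
    field_simp; linarith
  have hunorm : ‖p + d‖ ^ 2 = ‖p‖ ^ 2 + 2 * ⟪d, p⟫ + ‖d‖ ^ 2 := by
    rw [norm_add_sq_real, real_inner_comm]
  rw [← hw, hu]
  by_cases h1 : S.α k ≤ S.lam (k + 1)
  · simp only [h1, if_true]
    have h2 : ⟪p + d, p⟫ = ⟪S.f' (S.x (k + 1)), p⟫ + ⟪S.ξ (k + 1), p⟫ := by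
      rw [← inner_add_left, hu]
    rw [inner_add_left, real_inner_self_eq_norm_sq] at h2
    have h3 : 1 ≤ S.lam (k + 1) / S.α k := (one_le_div ha).mpr h1
    have h4 : ⟪d, p⟫ + ‖d‖ ^ 2 ≤ 0 := by rw [hdp]; nlinarith
    rw [zero_mul, zero_add, one_div, ← div_eq_inv_mul, le_div_iff₀ ha]
    have h5 : S.α k * (‖p‖ ^ 2 + ⟪d, p⟫) = S.α k * ⟪S.f' (S.x (k + 1)), p⟫
      + S.α k * ⟪S.ξ (k + 1), p⟫ := by rw [h2]; ring
    nlinarith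
  · by_cases h2 : S.α k / 2 < S.lam (k + 1)
    · simp only [h1, h2, if_true, if_false]
      have h3 : 1 / 2 ≤ S.lam (k + 1) / S.α k := by
        rw [le_div_iff₀ ha]; linarith
      rw [hunorm, hdp]
      nlinarith
    · simp only [h1, h2, if_false]
      push Not at h2
      have hcs : S.lam (k + 1) * ‖d‖ ≤ S.α k * ‖p‖ := by
        have h3 := neg_le_of_abs_le (abs_real_inner_le_norm d p)
        have hdn : 0 < ‖d‖ := by
          by_contra h
          have : ‖d‖ = 0 := le_antisymm (not_lt.mp h) (norm_nonneg d)
          simp [this] at hdpos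
        refine le_of_mul_le_mul_right ?_ hdn
        nlinarith [mul_le_mul_of_nonneg_left h3 ha.le]
      have hsq : S.lam (k + 1) ^ 2 * ‖d‖ ^ 2 ≤ S.α k ^ 2 * ‖p‖ ^ 2 := by
        rw [← mul_pow, ← mul_pow]
        exact pow_le_pow_left₀ (by positivity) hcs 2
      have hr : 0 ≤ 1 - 2 * (S.lam (k + 1) / S.α k) := by
        have : S.lam (k + 1) / S.α k ≤ 1 / 2 := by rw [div_le_iff₀ ha]; linarith
        linarith
      have key : ‖p + d‖ ^ 2 ≤ (S.α k - S.lam (k + 1)) ^ 2 / S.lam (k + 1) ^ 2 * ‖p‖ ^ 2 := by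
        rw [div_mul_eq_mul_div, le_div_iff₀ (by positivity), hunorm, hdp]
        have h6 := mul_le_mul_of_nonneg_left hsq hr
        have h7 : (1 - 2 * (S.lam (k + 1) / S.α k)) * (S.α k ^ 2 * ‖p‖ ^ 2)
          = (S.α k ^ 2 - 2 * S.lam (k + 1) * S.α k) * ‖p‖ ^ 2 := by field_simp
        nlinarith
      have h8 := mul_le_mul_of_nonneg_left hpw
        (show 0 ≤ (S.α k - S.lam (k + 1)) ^ 2 / S.lam (k + 1) ^ 2 by positivity)
      linarith
end
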